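/- In the first-price auction with machine-learned reserves of accuracy γ ∈ [0,1] and all bidders value maximizers (B_v = {1,…,n}, B_u = ∅), for every equilibrium strategy profile: Σ_i E[val i] ≥ (1/(2 − γ)) · Σ_j max_i v i j. -/

import Mathlib

open MeasureTheory Finset
open scoped Classical

namespace FPAR

variable {n m : ℕ}

/-- Bidder `i` wins auction `j` under bid profile `b` with reserves `r`: `i` bids at
least the reserve and has the highest bid among those meeting the reserve, ties broken
in favor of larger value, then smaller index. -/
def Wins (v b : Fin n → Fin m → ℝ) (r : Fin m → ℝ) (j : Fin m) (i : Fin n) : Prop :=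
  r j ≤ b i j ∧ ∀ i', i' ≠ i →
    b i' j < r j ∨ b i' j < b i j ∨
      (b i' j = b i j ∧ (v i' j < v i j ∨ (v i' j = v i j ∧ i < i')))

/-- Indicator that bidder `i` wins auction `j`. -/
noncomputable def xind (v b : Fin n → Fin m → ℝ) (r : Fin m → ℝ) (j : Fin m) (i : Fin n) : ℝ :=
  if Wins v b r j i then 1 else 0

noncomputable def valij (v b : Fin n → Fin m → ℝ) (r : Fin m → ℝ) (i : Fin n) (j : Fin m) : ℝ :=
  xind v b r j i * v i j

noncomputable def payij (v b : Fin n → Fin m → ℝ) (r : Fin m → ℝ) (i : Fin n) (j : Fin m) : ℝ :=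
  xind v b r j i * b i j

/-- Admissible strategy: probability distribution over nonnegative bid vectors
with finite expectations. -/
def Admissible (σ : Measure (Fin m → ℝ)) : Prop :=
  IsProbabilityMeasure σ ∧ (∀ᵐ β ∂σ, ∀ j, 0 ≤ β j) ∧ ∀ j, Integrable (fun β => β j) σ

noncomputable def EValij (v : Fin n → Fin m → ℝ) (r : Fin m → ℝ)
    (μ : Fin n → Measure (Fin m → ℝ)) (i : Fin n) (j : Fin m) : ℝ :=
  ∫ b, valij v b r i j ∂(Measure.pi μ)

noncomputable def EPayij (v : Fin n → Fin m → ℝ) (r : Fin m → ℝ)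
    (μ : Fin n → Measure (Fin m → ℝ)) (i : Fin n) (j : Fin m) : ℝ :=
  ∫ b, payij v b r i j ∂(Measure.pi μ)

noncomputable def EVal (v : Fin n → Fin m → ℝ) (r : Fin m → ℝ)
    (μ : Fin n → Measure (Fin m → ℝ)) (i : Fin n) : ℝ :=
  ∑ j, EValij v r μ i j

noncomputable def EPay (v : Fin n → Fin m → ℝ) (r : Fin m → ℝ)
    (μ : Fin n → Measure (Fin m → ℝ)) (i : Fin n) : ℝ :=
  ∑ j, EPayij v r μ i j

noncomputable def EUtil (v : Fin n → Fin m → ℝ) (r : Fin m → ℝ)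
    (μ : Fin n → Measure (Fin m → ℝ)) (i : Fin n) : ℝ :=
  EVal v r μ i - EPay v r μ i

/-- A utility maximizer best responds: no admissible deviation improves expected utility. -/
def UtilBest (v : Fin n → Fin m → ℝ) (r : Fin m → ℝ)
    (μ : Fin n → Measure (Fin m → ℝ)) (i : Fin n) : Prop :=
  ∀ σ, Admissible σ → EUtil v r (Function.update μ i σ) i ≤ EUtil v r μ i

/-- A value maximizer best responds: its ROI constraint holds and no admissible
deviation satisfying the ROI constraint yields more expected value. -/
def ValBest (v : Fin n → Fin m → ℝ) (r : Fin m → ℝ)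
    (μ : Fin n → Measure (Fin m → ℝ)) (i : Fin n) : Prop :=
  EPay v r μ i ≤ EVal v r μ i ∧
    ∀ σ, Admissible σ →
      EPay v r (Function.update μ i σ) i ≤ EVal v r (Function.update μ i σ) i →
      EVal v r (Function.update μ i σ) i ≤ EVal v r μ i

/-- Equilibrium: all strategies admissible, every utility maximizer in `Bu` and
every value maximizer in `Bv` best responds. -/
def Equilibrium (v : Fin n → Fin m → ℝ) (r : Fin m → ℝ) (Bu Bv : Finset (Fin n))
    (μ : Fin n → Measure (Fin m → ℝ)) : Prop :=
  (∀ i, Admissible (μ i)) ∧ (∀ i ∈ Bu, UtilBest v r μ i) ∧ (∀ i ∈ Bv, ValBest v r μ i)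

/-- The rightful winner of auction `j`: the bidder with the highest value,
ties broken toward the smaller index. -/
noncomputable def rwinner [NeZero n] (v : Fin n → Fin m → ℝ) (j : Fin m) : Fin n :=
  (Finset.univ.filter fun i => ∀ i', v i' j ≤ v i j).min' (by
    obtain ⟨i, -, hi⟩ := Finset.exists_max_image (Finset.univ : Finset (Fin n))
      (fun i => v i j) Finset.univ_nonempty
    exact ⟨i, Finset.mem_filter.mpr ⟨Finset.mem_univ _, fun i' => hi i' (Finset.mem_univ _)⟩⟩)

end FPAR

open MeasureTheory Finset

namespace FPAR

variable {n m : ℕ}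

/-- No bidder meets the reserve of auction `j`. -/
def Unsold (b : Fin n → Fin m → ℝ) (r : Fin m → ℝ) (j : Fin m) : Prop :=
  ∀ i, b i j < r j

/-- No competitor of the rightful winner of auction `j` bids above the highest value. -/
def NotOverbid [NeZero n] (v b : Fin n → Fin m → ℝ) (j : Fin m) : Prop :=
  ∀ i, i ≠ rwinner v j → b i j ≤ v (rwinner v j) j

/-- The bid profile in which bidder `i` replaces her bid vector by its image under `g`. -/
noncomputable def deviate (b : Fin n → Fin m → ℝ) (i : Fin n)
    (g : (Fin m → ℝ) → Fin m → ℝ) : Fin n → Fin m → ℝ :=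
  Function.update b i (g (b i))

/-- Raise the bid to the reserve in every auction whose rightful winner is `i`. -/
noncomputable def raise [NeZero n] (v : Fin n → Fin m → ℝ) (r : Fin m → ℝ) (i : Fin n)
    (β : Fin m → ℝ) : Fin m → ℝ :=
  fun j => if rwinner v j = i then max (β j) (r j) else β j

section Pointwise

variable {v b : Fin n → Fin m → ℝ} {r : Fin m → ℝ} {j : Fin m} {i : Fin n}

lemma rwinner_mem [NeZero n] (v : Fin n → Fin m → ℝ) (j : Fin m) :
    rwinner v j ∈ Finset.univ.filter fun i => ∀ i', v i' j ≤ v i j :=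
  Finset.min'_mem _ _

lemma le_rwinner [NeZero n] (v : Fin n → Fin m → ℝ) (i : Fin n) (j : Fin m) :
    v i j ≤ v (rwinner v j) j :=
  (Finset.mem_filter.mp (rwinner_mem v j)).2 i

lemma rwinner_lt_of_eq [NeZero n] (hi : i ≠ rwinner v j) (h : v i j = v (rwinner v j) j) :
    rwinner v j < i := by
  refine lt_of_le_of_ne (Finset.min'_le _ _ ?_) hi.symm
  exact Finset.mem_filter.mpr ⟨Finset.mem_univ _, fun i' => h ▸ le_rwinner v i' j⟩

lemma sup'_eq_rwinner [NeZero n] (v : Fin n → Fin m → ℝ) (j : Fin m) :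
    (Finset.univ.sup' Finset.univ_nonempty fun i => v i j) = v (rwinner v j) j :=
  le_antisymm (Finset.sup'_le _ _ fun i _ => le_rwinner v i j)
    (Finset.le_sup' (fun i => v i j) (Finset.mem_univ _))

lemma exists_wins (v : Fin n → Fin m → ℝ) (h : ¬ Unsold b r j) : ∃ i, Wins v b r j i := by
  simp only [Unsold, not_forall, not_lt] at h
  obtain ⟨i₀, h₀⟩ := h
  obtain ⟨i, hi, hmax⟩ := Finset.exists_max_image
    (Finset.univ.filter fun i => r j ≤ b i j)
    (fun i => toLex (b i j, toLex (v i j, OrderDual.toDual i)))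
    ⟨i₀, Finset.mem_filter.mpr ⟨Finset.mem_univ _, h₀⟩⟩
  refine ⟨i, (Finset.mem_filter.mp hi).2, fun i' hne => ?_⟩
  rcases lt_or_ge (b i' j) (r j) with hlt | hge
  · exact Or.inl hlt
  · have := hmax i' (Finset.mem_filter.mpr ⟨Finset.mem_univ _, hge⟩)
    simp only [Prod.Lex.toLex_le_toLex, OrderDual.toDual_le_toDual] at this
    rcases this with h | ⟨h, h' | ⟨h', h''⟩⟩
    · exact Or.inr (Or.inl h)
    · exact Or.inr (Or.inr ⟨h, Or.inl h'⟩)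
    · exact Or.inr (Or.inr ⟨h, Or.inr ⟨h', lt_of_le_of_ne h'' hne.symm⟩⟩)

lemma Wins.le (h : Wins v b r j i) (i' : Fin n) : b i' j ≤ b i j := by
  by_cases hi : i' = i
  · rw [hi]
  · rcases h.2 i' hi with h' | h' | h'
    · exact h'.le.trans h.1
    · exact h'.le
    · exact h'.1.le

lemma wins_rwinner [NeZero n] (hr : r j ≤ b (rwinner v j) j)
    (h : ∀ i, i ≠ rwinner v j → b i j ≤ b (rwinner v j) j) : Wins v b r j (rwinner v j) := by
  refine ⟨hr, fun i hi => Or.inr ?_⟩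
  rcases (h i hi).lt_or_eq with hlt | heq
  · exact Or.inl hlt
  · refine Or.inr ⟨heq, ?_⟩
    rcases (le_rwinner v i j).lt_or_eq with hv | hv
    · exact Or.inl hv
    · exact Or.inr ⟨hv, rwinner_lt_of_eq hi hv⟩

lemma xind_nonneg : 0 ≤ xind v b r j i := by
  unfold xind; split_ifs <;> norm_num

lemma xind_le_one : xind v b r j i ≤ 1 := by
  unfold xind; split_ifs <;> norm_num

lemma valij_nonneg (hv : 0 ≤ v i j) : 0 ≤ valij v b r i j :=
  mul_nonneg xind_nonneg hv

lemma payij_nonneg (hr : 0 ≤ r j) : 0 ≤ payij v b r i j := by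
  unfold payij xind
  split_ifs with h
  · simpa using hr.trans h.1
  · simp

lemma xind_congr {b' : Fin n → Fin m → ℝ} (h : ∀ i', b' i' j = b i' j) :
    xind v b' r j i = xind v b r j i := by
  have : Wins v b' r j i ↔ Wins v b r j i := by simp only [Wins, h]
  simp only [xind, this]

lemma payij_deviate_value : payij v (deviate b i fun _ => v i) r i j =
    valij v (deviate b i fun _ => v i) r i j := by
  simp [payij, valij, deviate]

lemma valij_deviate_value [NeZero n] (hv : ∀ i j, 0 ≤ v i j) (hr : r j ≤ v (rwinner v j) j) :
    (if rwinner v j = i then v (rwinner v j) j * (if NotOverbid v b j then 1 else 0) else 0) ≤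
      valij v (deviate b i fun _ => v i) r i j := by
  split_ifs with hi hA
  · subst hi
    have hw : Wins v (deviate b (rwinner v j) fun _ => v (rwinner v j)) r j (rwinner v j) := by
      apply wins_rwinner
      · simpa [deviate] using hr
      · intro i' hi'
        simpa [deviate, Function.update_of_ne hi'] using hA i' hi'
    simp [valij, xind, hw]
  · simpa using valij_nonneg (hv i j)
  · exact valij_nonneg (hv i j)

lemma deviate_raise_congr [NeZero n] (h : rwinner v j = i → r j ≤ b i j) (i' : Fin n) :
    deviate b i (raise v r i) i' j = b i' j := by
  by_cases hi : i' = i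
  · subst hi
    by_cases hw : rwinner v j = i'
    · simp [deviate, raise, hw, h hw]
    · simp [deviate, raise, hw]
  · simp [deviate, Function.update_of_ne hi]

lemma utility_le_deviate_raise [NeZero n] (hr : r j ≤ v (rwinner v j) j) :
    valij v b r i j - payij v b r i j ≤
      valij v (deviate b i (raise v r i)) r i j - payij v (deviate b i (raise v r i)) r i j := by
  by_cases h : rwinner v j = i → r j ≤ b i j
  · have h' := deviate_raise_congr (v := v) h
    simp only [valij, payij, xind_congr h', h', le_refl]
  · push Not at h
    obtain ⟨rfl, h⟩ := h
    have hx : xind v b r j (rwinner v j) = 0 := if_neg fun hw => h.not_ge hw.1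
    have hb : deviate b (rwinner v j) (raise v r (rwinner v j)) (rwinner v j) j = r j := by
      simp [deviate, raise, h.le]
    simp only [valij, payij, hx, hb, ← mul_sub, zero_mul, sub_zero]
    exact mul_nonneg xind_nonneg (sub_nonneg.mpr hr)

lemma valij_deviate_raise [NeZero n] (hv : ∀ i j, 0 ≤ v i j) :
    valij v b r i j +
        (if rwinner v j = i then v (rwinner v j) j * (if Unsold b r j then 1 else 0) else 0) ≤
      valij v (deviate b i (raise v r i)) r i j := by
  by_cases h : rwinner v j = i → r j ≤ b i j
  · have h' := deviate_raise_congr (v := v) h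
    simp only [valij, xind_congr h']
    split_ifs with hi hU
    · exact absurd (hU i) (h hi).not_gt
    · simp
    · simp
  · push Not at h
    obtain ⟨rfl, h⟩ := h
    have hx : xind v b r j (rwinner v j) = 0 := if_neg fun hw => h.not_ge hw.1
    have hb : deviate b (rwinner v j) (raise v r (rwinner v j)) (rwinner v j) j = r j := by
      simp [deviate, raise, h.le]
    by_cases hU : Unsold b r j
    · have hw : Wins v (deviate b (rwinner v j) (raise v r (rwinner v j))) r j
          (rwinner v j) := by
        apply wins_rwinner hb.ge
        intro i' hi'
        rw [hb]
        simpa [deviate, Function.update_of_ne hi'] using (hU i').le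
      simp only [valij, hx]
      simp [xind, hU, hw]
    · simpa [valij, hx, hU] using mul_nonneg xind_nonneg (hv (rwinner v j) j)

lemma le_sum_payij [NeZero n] {γ : ℝ} (hγ : 0 ≤ γ) (hv : ∀ i j, 0 ≤ v i j)
    (hγr : γ * v (rwinner v j) j ≤ r j) (hr : r j ≤ v (rwinner v j) j) :
    v (rwinner v j) j * (1 - (1 - γ) * (if NotOverbid v b j then 1 else 0)
      - γ * (if Unsold b r j then 1 else 0)) ≤ ∑ i, payij v b r i j := by
  have hr0 : 0 ≤ r j := (mul_nonneg hγ (hv _ _)).trans hγr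
  by_cases hU : Unsold b r j
  · have hA : NotOverbid v b j := fun i _ => (hU i).le.trans hr
    simpa [hU, hA] using Finset.sum_nonneg fun i _ => payij_nonneg (v := v) (b := b) (i := i) hr0
  · obtain ⟨i, hi⟩ := exists_wins v hU
    have hb : b i j ≤ ∑ i, payij v b r i j := by
      have := Finset.single_le_sum (fun i _ => payij_nonneg (v := v) (b := b) (i := i) hr0)
        (Finset.mem_univ i)
      simpa [payij, xind, hi] using this
    refine le_trans ?_ hb
    by_cases hA : NotOverbid v b j
    · simp only [hA, hU, if_true, if_false]
      linarith [hi.1]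
    · simp only [hA, hU, if_false]
      simp only [NotOverbid, not_forall, not_le] at hA
      obtain ⟨i', -, hi'⟩ := hA
      linarith [hi.le i']

end Pointwise

section Measurability

variable (v : Fin n → Fin m → ℝ) (r : Fin m → ℝ)

lemma measurable_bid (i : Fin n) (j : Fin m) :
    Measurable fun b : Fin n → Fin m → ℝ => b i j :=
  (measurable_pi_apply j).comp (measurable_pi_apply i)

lemma measurableSet_wins (j : Fin m) (i : Fin n) : MeasurableSet {b | Wins v b r j i} := by
  have h := measurable_bid (n := n) (m := m)
  simp only [Wins, Set.ofPred_and, Set.ofPred_forall]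
  refine (measurableSet_le measurable_const (h i j)).inter ?_
  refine MeasurableSet.iInter fun i' => MeasurableSet.iInter fun _ => ?_
  refine (measurableSet_lt (h i' j) measurable_const).union
    ((measurableSet_lt (h i' j) (h i j)).union ?_)
  exact (measurableSet_eq_fun (h i' j) (h i j)).inter (MeasurableSet.const _)

lemma measurableSet_unsold (j : Fin m) :
    MeasurableSet {b : Fin n → Fin m → ℝ | Unsold b r j} := by
  simp only [Unsold, Set.ofPred_forall]
  exact MeasurableSet.iInter fun i => measurableSet_lt (measurable_bid i j) measurable_const

lemma measurableSet_notOverbid [NeZero n] (j : Fin m) :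
    MeasurableSet {b | NotOverbid v b j} := by
  simp only [NotOverbid, Set.ofPred_forall]
  exact MeasurableSet.iInter fun i => MeasurableSet.iInter fun _ =>
    measurableSet_le (measurable_bid i j) measurable_const

lemma measurable_xind (j : Fin m) (i : Fin n) : Measurable fun b => xind v b r j i :=
  Measurable.ite (measurableSet_wins v r j i) measurable_const measurable_const

lemma measurable_valij (i : Fin n) (j : Fin m) : Measurable fun b => valij v b r i j :=
  (measurable_xind v r j i).mul_const _

lemma measurable_payij (i : Fin n) (j : Fin m) : Measurable fun b => payij v b r i j :=
  (measurable_xind v r j i).mul (measurable_bid i j)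

lemma measurable_raise [NeZero n] (i : Fin n) : Measurable (raise v r i) := by
  refine measurable_pi_lambda _ fun j => ?_
  by_cases h : rwinner v j = i
  · simpa [raise, h] using (measurable_pi_apply j).max measurable_const
  · simpa [raise, h] using measurable_pi_apply j

end Measurability

section Expectation

variable {v : Fin n → Fin m → ℝ} {r : Fin m → ℝ} {μ : Fin n → Measure (Fin m → ℝ)}

lemma integrable_indicator {α : Type*} [MeasurableSpace α] {P : Measure α} [IsFiniteMeasure P]
    {s : α → Prop} (hs : MeasurableSet {a | s a}) :
    Integrable (fun a => if s a then (1 : ℝ) else 0) P :=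
  Integrable.of_bound (Measurable.ite hs measurable_const measurable_const).aestronglyMeasurable 1
    (Filter.Eventually.of_forall fun a => by split_ifs <;> simp)

lemma measurable_deviate (i : Fin n) {g : (Fin m → ℝ) → Fin m → ℝ} (hg : Measurable g) :
    Measurable fun b : Fin n → Fin m → ℝ => deviate b i g := by
  refine measurable_pi_lambda _ fun k => ?_
  by_cases h : k = i
  · subst h
    simpa [deviate, Function.comp_def] using hg.comp (measurable_pi_apply k)
  · simpa [deviate, Function.update_of_ne h] using measurable_pi_apply k

/-- A deviation that transforms the bid vector of a single bidder is coupled with the original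
profile. -/
lemma pi_update_map (hμ : ∀ i, IsProbabilityMeasure (μ i)) (i : Fin n)
    {g : (Fin m → ℝ) → Fin m → ℝ} (hg : Measurable g) :
    Measure.pi (Function.update μ i ((μ i).map g)) =
      (Measure.pi μ).map fun b => deviate b i g := by
  set f : Fin n → (Fin m → ℝ) → Fin m → ℝ := Function.update (fun _ => id) i g with hf
  have hfm : ∀ k, Measurable (f k) := fun k => by
    by_cases h : k = i
    · subst h; simpa [hf] using hg
    · simpa [hf, Function.update_of_ne h] using measurable_id
  have : ∀ k, IsProbabilityMeasure ((μ k).map (f k)) := fun k =>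
    Measure.isProbabilityMeasure_map (hfm k).aemeasurable
  have hmap := Measure.pi_map_pi (μ := μ) (f := f) (fun k => (hfm k).aemeasurable)
  have h₁ : (fun k => (μ k).map (f k)) = Function.update μ i ((μ i).map g) := by
    funext k
    by_cases h : k = i
    · subst h; simp [hf]
    · simp [hf, Function.update_of_ne h]
  have h₂ : (fun (b : Fin n → Fin m → ℝ) k => f k (b k)) = fun b => deviate b i g := by
    funext b k
    by_cases h : k = i
    · subst h; simp [hf, deviate]
    · simp [hf, deviate, Function.update_of_ne h]
  rw [← h₁, ← hmap, h₂]

lemma EValij_deviate (hμ : ∀ i, IsProbabilityMeasure (μ i)) (i : Fin n) (j : Fin m)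
    {g : (Fin m → ℝ) → Fin m → ℝ} (hg : Measurable g) :
    EValij v r (Function.update μ i ((μ i).map g)) i j =
      ∫ b, valij v (deviate b i g) r i j ∂Measure.pi μ := by
  rw [EValij, pi_update_map hμ i hg, integral_map (measurable_deviate i hg).aemeasurable
    (measurable_valij v r i j).aestronglyMeasurable]

lemma EPayij_deviate (hμ : ∀ i, IsProbabilityMeasure (μ i)) (i : Fin n) (j : Fin m)
    {g : (Fin m → ℝ) → Fin m → ℝ} (hg : Measurable g) :
    EPayij v r (Function.update μ i ((μ i).map g)) i j =
      ∫ b, payij v (deviate b i g) r i j ∂Measure.pi μ := by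
  rw [EPayij, pi_update_map hμ i hg, integral_map (measurable_deviate i hg).aemeasurable
    (measurable_payij v r i j).aestronglyMeasurable]

lemma integrable_bid (hμ : ∀ i, Admissible (μ i)) (i : Fin n) (j : Fin m) :
    Integrable (fun b : Fin n → Fin m → ℝ => b i j) (Measure.pi μ) := by
  have := fun i => (hμ i).1
  exact (measurePreserving_eval μ i).integrable_comp_of_integrable ((hμ i).2.2 j)

lemma integrable_valij (hμ : ∀ i, Admissible (μ i)) (i : Fin n) (j : Fin m) :
    Integrable (fun b => valij v b r i j) (Measure.pi μ) := by
  have := fun i => (hμ i).1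
  exact (integrable_indicator (measurableSet_wins v r j i)).mul_const _

lemma integrable_payij (hμ : ∀ i, Admissible (μ i)) (i : Fin n) (j : Fin m) :
    Integrable (fun b => payij v b r i j) (Measure.pi μ) := by
  refine (integrable_bid hμ i j).mono (measurable_payij v r i j).aestronglyMeasurable
    (Filter.Eventually.of_forall fun b => ?_)
  rw [payij, norm_mul, Real.norm_of_nonneg xind_nonneg]
  exact mul_le_of_le_one_left (norm_nonneg _) xind_le_one

lemma Admissible.update_map (hμ : ∀ i, Admissible (μ i)) {i : Fin n}
    {g : (Fin m → ℝ) → Fin m → ℝ} (h : Admissible ((μ i).map g)) (k : Fin n) :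
    Admissible (Function.update μ i ((μ i).map g) k) := by
  by_cases hk : k = i
  · subst hk; simpa using h
  · simpa [Function.update_of_ne hk] using hμ k

lemma integrable_valij_deviate (hμ : ∀ i, Admissible (μ i)) {i : Fin n} (j : Fin m)
    {g : (Fin m → ℝ) → Fin m → ℝ} (hg : Measurable g) (h : Admissible ((μ i).map g)) :
    Integrable (fun b => valij v (deviate b i g) r i j) (Measure.pi μ) := by
  have := integrable_valij (v := v) (r := r) (Admissible.update_map hμ h) i j
  rw [pi_update_map (fun i => (hμ i).1) i hg] at this
  exact this.comp_measurable (measurable_deviate i hg)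

lemma integrable_payij_deviate (hμ : ∀ i, Admissible (μ i)) {i : Fin n} (j : Fin m)
    {g : (Fin m → ℝ) → Fin m → ℝ} (hg : Measurable g) (h : Admissible ((μ i).map g)) :
    Integrable (fun b => payij v (deviate b i g) r i j) (Measure.pi μ) := by
  have := integrable_payij (v := v) (r := r) (Admissible.update_map hμ h) i j
  rw [pi_update_map (fun i => (hμ i).1) i hg] at this
  exact this.comp_measurable (measurable_deviate i hg)

lemma admissible_map_const (hμ : ∀ i, Admissible (μ i)) (i : Fin n) {w : Fin m → ℝ}
    (hw : ∀ j, 0 ≤ w j) : Admissible ((μ i).map fun _ => w) := by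
  have := (hμ i).1
  refine ⟨Measure.isProbabilityMeasure_map measurable_const.aemeasurable, ?_, fun j => ?_⟩
  · simpa [Measure.map_const] using hw
  · exact (integrable_map_measure (measurable_pi_apply j).aestronglyMeasurable
      measurable_const.aemeasurable).mpr (integrable_const (w j))

lemma admissible_map_raise [NeZero n] (hμ : ∀ i, Admissible (μ i)) (i : Fin n) :
    Admissible ((μ i).map (raise v r i)) := by
  have := (hμ i).1
  have hm := measurable_raise v r i
  refine ⟨Measure.isProbabilityMeasure_map hm.aemeasurable, ?_, fun j => ?_⟩
  · rw [ae_map_iff hm.aemeasurable]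
    · filter_upwards [(hμ i).2.1] with β hβ j
      unfold raise
      split_ifs
      · exact (hβ j).trans (le_max_left _ _)
      · exact hβ j
    · simp only [Set.ofPred_forall]
      exact MeasurableSet.iInter fun j => measurableSet_le measurable_const (measurable_pi_apply j)
  · rw [integrable_map_measure (measurable_pi_apply j).aestronglyMeasurable hm.aemeasurable]
    by_cases h : rwinner v j = i
    · simp only [raise, h, if_true, Function.comp_def]
      exact ((hμ i).2.2 j).sup (integrable_const (r j))
    · simpa [raise, h, Function.comp_def] using (hμ i).2.2 j

/-- Probability that auction `j` remains unsold. -/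
noncomputable def unsoldProb (r : Fin m → ℝ) (μ : Fin n → Measure (Fin m → ℝ)) (j : Fin m) : ℝ :=
  ∫ b, (if Unsold b r j then (1 : ℝ) else 0) ∂Measure.pi μ

/-- Probability that the rightful winner of auction `j` is not outbid at her value. -/
noncomputable def notOverbidProb [NeZero n] (v : Fin n → Fin m → ℝ)
    (μ : Fin n → Measure (Fin m → ℝ)) (j : Fin m) : ℝ :=
  ∫ b, (if NotOverbid v b j then (1 : ℝ) else 0) ∂Measure.pi μ

lemma sum_rwinner_comm [NeZero n] (f : Fin m → ℝ) :
    ∑ i, ∑ j, (if rwinner v j = i then f j else 0) = ∑ j, f j := by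
  rw [Finset.sum_comm]
  simp

lemma notOverbid_le_EVal [NeZero n] (hμ : ∀ i, Admissible (μ i)) (hv : ∀ i j, 0 ≤ v i j)
    (hr : ∀ j, r j ≤ v (rwinner v j) j) {i : Fin n} (hb : ValBest v r μ i) :
    ∑ j, (if rwinner v j = i then v (rwinner v j) j * notOverbidProb v μ j else 0) ≤
      EVal v r μ i := by
  have hp := fun i => (hμ i).1
  have had := admissible_map_const hμ i (hv i)
  have hg : Measurable fun _ : Fin m → ℝ => v i := measurable_const
  refine le_trans ?_ (hb.2 _ had ?_)
  · refine Finset.sum_le_sum fun j _ => ?_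
    rw [EValij_deviate hp i j hg]
    have hI : Integrable (fun b => if NotOverbid v b j then (1 : ℝ) else 0) (Measure.pi μ) :=
      integrable_indicator (measurableSet_notOverbid v j)
    have := integral_mono (μ := Measure.pi μ)
      (f := fun b => if rwinner v j = i then
        v (rwinner v j) j * (if NotOverbid v b j then 1 else 0) else 0) ?_
      (integrable_valij_deviate (v := v) (r := r) hμ j hg had)
      (fun b => valij_deviate_value hv (hr j))
    · refine le_trans (le_of_eq ?_) this
      split_ifs
      · rw [integral_const_mul, notOverbidProb]
      · simp
    · split_ifs
      · exact hI.const_mul _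
      · simp
  · refine Finset.sum_le_sum fun j _ => ?_
    rw [EValij_deviate hp i j hg, EPayij_deviate hp i j hg]
    simp only [payij_deviate_value, le_refl]

lemma unsold_nonpos [NeZero n] (hμ : ∀ i, Admissible (μ i)) (hv : ∀ i j, 0 ≤ v i j)
    (hr : ∀ j, r j ≤ v (rwinner v j) j) {i : Fin n} (hb : ValBest v r μ i) :
    ∑ j, (if rwinner v j = i then v (rwinner v j) j * unsoldProb r μ j else 0) ≤ 0 := by
  have hp := fun i => (hμ i).1
  have had := admissible_map_raise (v := v) (r := r) hμ i
  have hg := measurable_raise v r i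
  have hval : EVal v r μ i +
      ∑ j, (if rwinner v j = i then v (rwinner v j) j * unsoldProb r μ j else 0) ≤
      EVal v r (Function.update μ i ((μ i).map (raise v r i))) i := by
    rw [EVal, EVal, ← Finset.sum_add_distrib]
    refine Finset.sum_le_sum fun j _ => ?_
    rw [EValij_deviate hp i j hg]
    have hI : Integrable (fun b => if rwinner v j = i then
        v (rwinner v j) j * (if Unsold b r j then (1 : ℝ) else 0) else 0) (Measure.pi μ) := by
      split_ifs
      · exact (integrable_indicator (measurableSet_unsold r j)).const_mul _
      · simp
    have := integral_mono ((integrable_valij (v := v) (r := r) hμ i j).add hI)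
      (integrable_valij_deviate (v := v) (r := r) hμ j hg had)
      (fun b => valij_deviate_raise hv)
    rw [integral_add' (integrable_valij hμ i j) hI] at this
    refine le_trans (le_of_eq ?_) this
    rw [EValij]
    congr 1
    split_ifs
    · rw [integral_const_mul, unsoldProb]
    · simp
  have hroi : EVal v r μ i - EPay v r μ i ≤
      EVal v r (Function.update μ i ((μ i).map (raise v r i))) i -
        EPay v r (Function.update μ i ((μ i).map (raise v r i))) i := by
    simp only [EVal, EPay, ← Finset.sum_sub_distrib]
    refine Finset.sum_le_sum fun j _ => ?_
    rw [EValij_deviate hp i j hg, EPayij_deviate hp i j hg, EValij, EPayij,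
      ← integral_sub (integrable_valij hμ i j) (integrable_payij hμ i j),
      ← integral_sub (integrable_valij_deviate hμ j hg had)
        (integrable_payij_deviate hμ j hg had)]
    exact integral_mono ((integrable_valij hμ i j).sub (integrable_payij hμ i j))
      ((integrable_valij_deviate hμ j hg had).sub (integrable_payij_deviate hμ j hg had))
      (fun b => utility_le_deviate_raise (hr j))
  have := hb.2 _ had (by linarith [hb.1])
  linarith

lemma le_sum_EPay [NeZero n] {γ : ℝ} (hγ : 0 ≤ γ) (hμ : ∀ i, Admissible (μ i))
    (hv : ∀ i j, 0 ≤ v i j) (hγr : ∀ j, γ * v (rwinner v j) j ≤ r j)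
    (hr : ∀ j, r j ≤ v (rwinner v j) j) :
    ∑ j, v (rwinner v j) j * (1 - (1 - γ) * notOverbidProb v μ j - γ * unsoldProb r μ j) ≤
      ∑ i, EPay v r μ i := by
  have hp := fun i => (hμ i).1
  simp only [EPay]
  rw [Finset.sum_comm]
  refine Finset.sum_le_sum fun j _ => ?_
  have hA : Integrable (fun b => (1 - γ) * if NotOverbid v b j then (1 : ℝ) else 0)
      (Measure.pi μ) := (integrable_indicator (measurableSet_notOverbid v j)).const_mul _
  have hU : Integrable (fun b => γ * if Unsold b r j then (1 : ℝ) else 0)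
      (Measure.pi μ) := (integrable_indicator (measurableSet_unsold r j)).const_mul _
  have h1A := (integrable_const (μ := Measure.pi μ) (1 : ℝ)).sub hA
  have := integral_mono ((h1A.sub hU).const_mul (v (rwinner v j) j))
    (integrable_finsetSum Finset.univ fun i _ => integrable_payij (v := v) (r := r) hμ i j)
    (fun b => le_sum_payij hγ hv (hγr j) (hr j))
  rw [integral_finsetSum _ fun i _ => integrable_payij hμ i j, integral_const_mul,
    integral_sub' h1A hU, integral_sub' (integrable_const _) hA, integral_const_mul,
    integral_const_mul] at this
  simpa [EPayij, notOverbidProb, unsoldProb] using this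

end Expectation

end FPAR

/-- Corollary 1 of the paper. In any equilibrium of the first-price
auction with machine-learned reserves of accuracy `γ ∈ [0,1]` and all bidders value
maximizers, the welfare is at least `1/(2 - γ)` times the optimal welfare. -/
theorem fpa_ml_reserves_full_autobidding {n m : ℕ} [NeZero n]
    (γ : ℝ) (hγ : γ ∈ Set.Icc (0 : ℝ) 1)
    (v : Fin n → Fin m → ℝ) (hv : ∀ i j, 0 ≤ v i j)
    (r : Fin m → ℝ)
    (hr : ∀ j, γ * (Finset.univ.sup' Finset.univ_nonempty fun i => v i j) ≤ r j ∧
      r j ≤ Finset.univ.sup' Finset.univ_nonempty fun i => v i j)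
    (μ : Fin n → Measure (Fin m → ℝ))
    (heq : FPAR.Equilibrium v r (∅ : Finset (Fin n)) (Finset.univ : Finset (Fin n)) μ)
    (hOPT : 0 < ∑ j, Finset.univ.sup' Finset.univ_nonempty fun i => v i j) :
    ∑ i, FPAR.EVal v r μ i ≥
      (1 / (2 - γ)) * ∑ j, Finset.univ.sup' Finset.univ_nonempty fun i => v i j := by
  obtain ⟨hγ0, hγ1⟩ := hγ
  obtain ⟨hμ, -, hb⟩ := heq
  simp only [FPAR.sup'_eq_rwinner] at hr ⊢
  have hW := Finset.sum_le_sum fun i (_ : i ∈ Finset.univ) =>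
    FPAR.notOverbid_le_EVal hμ hv (fun j => (hr j).2) (hb i (Finset.mem_univ i))
  have hU := Finset.sum_le_sum fun i (_ : i ∈ Finset.univ) =>
    FPAR.unsold_nonpos hμ hv (fun j => (hr j).2) (hb i (Finset.mem_univ i))
  rw [FPAR.sum_rwinner_comm] at hW hU
  rw [Finset.sum_const_zero] at hU
  have hP := FPAR.le_sum_EPay hγ0 hμ hv (fun j => (hr j).1) (fun j => (hr j).2)
  have hPW := Finset.sum_le_sum fun i (_ : i ∈ Finset.univ) => (hb i (Finset.mem_univ i)).1
  have hsplit : ∑ j, v (FPAR.rwinner v j) j *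
      (1 - (1 - γ) * FPAR.notOverbidProb v μ j - γ * FPAR.unsoldProb r μ j) =
      ∑ j, v (FPAR.rwinner v j) j
        - (1 - γ) * ∑ j, v (FPAR.rwinner v j) j * FPAR.notOverbidProb v μ j
        - γ * ∑ j, v (FPAR.rwinner v j) j * FPAR.unsoldProb r μ j := by
    rw [Finset.mul_sum, Finset.mul_sum, ← Finset.sum_sub_distrib, ← Finset.sum_sub_distrib]
    exact Finset.sum_congr rfl fun j _ => by ring
  rw [hsplit] at hP
  have h₁ := mul_le_mul_of_nonneg_left hW (sub_nonneg.mpr hγ1)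
  have h₂ := mul_le_mul_of_nonneg_left hU hγ0
  rw [ge_iff_le, one_div_mul_eq_div, div_le_iff₀ (by linarith)]
  linarith
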